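/- If the two-argument halting predicate were computable, then every strongly intransitive game with computable best responses would admit a universal winning algorithm: assuming ComputablePred (fun p : Nat.Partrec.Code × ℕ => (p.1.eval p.2).Dom), there exists a code c such that for every code d, c.eval (encode d) halts, and whenever d.eval (encode c) = Part.some q, the output p of c.eval (encode d) satisfies C p q = 1. -/

import Mathlib

open Nat.Partrec (Code)
open Encodable (encode)

/-- If the two-argument halting predicate were computable, then every strongly
intransitive game with a computable best response `S'` for player 1 would admit
a universal winning algorithm. -/
theorem universal_winner_of_computable_halting
    (hH : ComputablePred (fun p : Nat.Partrec.Code × ℕ => (p.1.eval p.2).Dom))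
    (C : ℕ → ℕ → ℤ) (hC : ∀ p q, C p q = -1 ∨ C p q = 0 ∨ C p q = 1)
    (S' : ℕ → ℕ) (hS' : Computable S') (hbeats : ∀ q, C (S' q) q = 1) :
    ∃ c : Code, (∀ d : Code, (c.eval (encode d)).Dom) ∧
      ∀ d : Code, ∀ q : ℕ, d.eval (encode c) = Part.some q →
        ∀ p : ℕ, c.eval (encode d) = Part.some p → C p q = 1 := by
  obtain ⟨halts, hhalts, hdom⟩ := ComputablePred.computable_iff.1 hH
  have hiff (d : Code) (n : ℕ) : (d.eval n).Dom ↔ halts (d, n) = true :=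
    iff_of_eq (congrFun hdom (d, n))
  -- Run the opponent on our own code if that halts and answer optimally; otherwise play `0`.
  let respond : Code → ℕ →. ℕ := fun c n =>
    bif halts (Denumerable.ofNat Code n, encode c) then
      ((Denumerable.ofNat Code n).eval (encode c)).map S'
    else Part.some 0
  have hargs : Computable fun x : Code × ℕ => (Denumerable.ofNat Code x.2, encode x.1) :=
    ((Computable.ofNat Code).comp Computable.snd).pair (Computable.encode.comp Computable.fst)
  have heval : Partrec fun x : Code × ℕ =>
      (Denumerable.ofNat Code x.2).eval (encode x.1) :=
    Code.eval_part.comp ((Computable.ofNat Code).comp Computable.snd)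
      (Computable.encode.comp Computable.fst)
  have hrespond : Partrec₂ respond :=
    Partrec.cond (hhalts.comp hargs) (heval.map (hS'.comp Computable.snd).to₂)
      (Computable.const 0).partrec
  obtain ⟨c, hc⟩ := Code.fixed_point₂ hrespond
  refine ⟨c, fun d => ?_, fun d q hq p hp => ?_⟩
  · rw [hc]
    cases h : halts (d, encode c) with
    | true => simpa [respond, h] using (hiff d (encode c)).2 h
    | false => simp [respond, h]
  · have h : halts (d, encode c) = true := (hiff d (encode c)).1 (by simp [hq])
    have hp' : S' q = p := by simpa [hc, respond, h, hq] using hp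
    exact hp' ▸ hbeats q
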